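/- For every real m > 1 and every n ≥ 1, the generalized Ramanujan m-prime R_n^{(m)}, defined as the smallest positive integer such that π(x) − π(x/m) ≥ n for all real x ≥ R_n^{(m)}, exists and is a prime number. -/

import Mathlib

/-- Prime counting function extended to real arguments. -/
noncomputable def piR (x : ℝ) : ℕ := Nat.primeCounting ⌊x⌋₊

open ArithmeticFunction Filter Topology MeasureTheory SchwartzMap
open scoped FourierTransform

theorem exists_continuousOn_eq_LSeries_vonMangoldt_sub :
    ∃ G : ℂ → ℂ, ContinuousOn G {s | 1 ≤ s.re} ∧
      ∀ s : ℂ, 1 < s.re → LSeries (fun n ↦ (Λ n : ℂ)) s = G s + 1 / (s - 1) := by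
  refine ⟨vonMangoldt.LFunctionResidueClassAux (1 : ZMod 1),
    vonMangoldt.continuousOn_LFunctionResidueClassAux 1, fun s hs ↦ ?_⟩
  have h := vonMangoldt.eqOn_LFunctionResidueClassAux (a := (1 : ZMod 1)) isUnit_one hs
  have h1 : vonMangoldt.residueClass (1 : ZMod 1) = Λ := by
    ext n
    simp [vonMangoldt.residueClass, Subsingleton.elim (n : ZMod 1) 1]
  rw [h, h1]
  simp

theorem norm_exp_two_pi_mul_I (t u : ℝ) :
    ‖Complex.exp (2 * Real.pi * t * u * Complex.I)‖ = 1 := by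
  simpa using Complex.norm_exp_ofReal_mul_I (2 * Real.pi * t * u)

theorem norm_exp_neg_two_pi_mul_I (t y : ℝ) :
    ‖Complex.exp (-(2 * Real.pi * t * y * Complex.I))‖ = 1 := by
  simpa using Complex.norm_exp_ofReal_mul_I (-(2 * Real.pi * t * y))

theorem fourier_sub_eq (f : ℝ → ℂ) (y u : ℝ) :
    𝓕 f (y - u) = ∫ t : ℝ, f t * Complex.exp (2 * Real.pi * t * u * Complex.I) *
      Complex.exp (-(2 * Real.pi * t * y * Complex.I)) := by
  rw [Real.fourier_real_eq_integral_exp_smul]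
  congr with t
  rw [smul_eq_mul, mul_comm, mul_assoc (f t), ← Complex.exp_add]
  push_cast
  ring_nf

theorem hasSum_vonMangoldt_mul_fourier (f : 𝓢(ℝ, ℂ)) {σ : ℝ} (hσ : 1 < σ) (u : ℝ) :
    HasSum (fun n : ℕ ↦ ((Λ n * (n : ℝ) ^ (-σ) : ℝ) : ℂ) * 𝓕 (f : ℝ → ℂ) (Real.log n - u))
      (∫ t : ℝ, f t * Complex.exp (2 * Real.pi * t * u * Complex.I) *
        LSeries (fun n ↦ (Λ n : ℂ)) (σ + 2 * Real.pi * t * Complex.I)) := by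
  have hs : Summable fun n : ℕ ↦ Λ n * (n : ℝ) ^ (-σ) := by
    have h := (LSeriesSummable_vonMangoldt (s := σ) (by simpa using hσ)).norm
    refine h.congr fun n ↦ ?_
    rcases eq_or_ne n 0 with rfl | hn
    · simp
    · rw [LSeries.norm_term_eq]
      simp [hn, Real.rpow_neg, div_eq_mul_inv, abs_of_nonneg vonMangoldt_nonneg]
  set g : ℕ → ℝ → ℂ := fun n t ↦ ((Λ n * (n : ℝ) ^ (-σ) : ℝ) : ℂ) *
    (f t * Complex.exp (2 * Real.pi * t * u * Complex.I) *
      Complex.exp (-(2 * Real.pi * t * (Real.log n : ℝ) * Complex.I)))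
  have hgnorm (n : ℕ) (t : ℝ) : ‖g n t‖ = (Λ n * (n : ℝ) ^ (-σ)) * ‖f t‖ := by
    simp only [g, norm_mul, norm_exp_two_pi_mul_I, norm_exp_neg_two_pi_mul_I, mul_one,
      Complex.norm_real, Real.norm_eq_abs]
    rw [abs_of_nonneg vonMangoldt_nonneg, abs_of_nonneg (by positivity)]
  have hgint (n : ℕ) : Integrable (g n) := by
    refine (f.integrable.norm.const_mul (Λ n * (n : ℝ) ^ (-σ))).mono'
      (Continuous.aestronglyMeasurable ?_) (ae_of_all _ fun t ↦ (hgnorm n t).le)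
    have := f.continuous
    fun_prop
  have hsum := hasSum_integral_of_summable_integral_norm hgint (by
    simp_rw [hgnorm, integral_const_mul]
    exact hs.mul_right _)
  convert! hsum using 1
  · ext n
    rw [fourier_sub_eq, ← integral_const_mul]
  · congr with t
    rw [LSeries, ← tsum_mul_left]
    congr with n
    rcases eq_or_ne n 0 with rfl | hn
    · simp [g]
    have hn' : (n : ℂ) ≠ 0 := by exact_mod_cast hn
    simp only [g]
    rw [LSeries.term_of_ne_zero hn, Complex.ofReal_mul, Complex.ofReal_cpow (by positivity),
      div_eq_mul_inv, ← Complex.cpow_neg, neg_add, Complex.cpow_add _ _ hn',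
      Complex.cpow_def_of_ne_zero hn' (-(2 * Real.pi * t * Complex.I)), ← Complex.natCast_log]
    push_cast
    ring_nf

theorem setIntegral_exp_mul_fourier (f : 𝓢(ℝ, ℂ)) {σ : ℝ} (hσ : 1 < σ) (u : ℝ) :
    ∫ y in Set.Ioi (0 : ℝ), Complex.exp (-(σ - 1) * y) * 𝓕 (f : ℝ → ℂ) (y - u) =
      ∫ t : ℝ, f t * Complex.exp (2 * Real.pi * t * u * Complex.I) *
        (1 / (σ + 2 * Real.pi * t * Complex.I - 1)) := by
  simp_rw [fourier_sub_eq, ← integral_const_mul]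
  rw [integral_integral_swap]
  · congr with t
    have hre : (-(σ - 1 : ℂ) - 2 * Real.pi * t * Complex.I).re < 0 := by
      simp; linarith
    have h := integral_exp_mul_complex_Ioi hre 0
    rw [show (1 / (σ + 2 * Real.pi * t * Complex.I - 1) : ℂ) =
        ∫ y in Set.Ioi (0 : ℝ), Complex.exp ((-(σ - 1 : ℂ) - 2 * Real.pi * t * Complex.I) * y) by
      rw [h, show (-(σ - 1 : ℂ) - 2 * Real.pi * t * Complex.I) =
        -(σ + 2 * Real.pi * t * Complex.I - 1) by ring, Complex.ofReal_zero, mul_zero,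
        Complex.exp_zero, neg_div_neg_eq], ← integral_const_mul]
    congr with y
    rw [show (-(σ - 1 : ℂ) - 2 * Real.pi * t * Complex.I) * y =
      -(σ - 1) * y + -(2 * Real.pi * t * y * Complex.I) by ring, Complex.exp_add]
    ring
  · have h1 : IntegrableOn (fun y : ℝ ↦ Real.exp (-(σ - 1) * y)) (Set.Ioi 0) :=
      integrableOn_exp_mul_Ioi (by linarith) 0
    refine (h1.mul_prod f.integrable.norm).mono' (Continuous.aestronglyMeasurable ?_)
      (ae_of_all _ fun z ↦ ?_)
    · have := f.continuous
      simp only [Function.uncurry_def]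
      fun_prop
    · simp only [Function.uncurry_def, norm_mul, Complex.norm_exp]
      simp

theorem integral_fourier_eq_apply_zero (f : 𝓢(ℝ, ℂ)) : ∫ y, 𝓕 (f : ℝ → ℂ) y = f 0 := by
  have h := congrFun (f.continuous.fourierInv_fourier_eq f.integrable (𝓕 f).integrable) 0
  rw [Real.fourierInv_eq'] at h
  simpa using h

theorem tendsto_setIntegral_Ioi_fourier_sub (f : 𝓢(ℝ, ℂ)) :
    Tendsto (fun u : ℝ ↦ ∫ y in Set.Ioi (0 : ℝ), 𝓕 (f : ℝ → ℂ) (y - u)) atTop (𝓝 (f 0)) := by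
  have h := (aecover_Ioi (μ := volume)
    tendsto_neg_atTop_atBot).integral_tendsto_of_countably_generated
    (f := 𝓕 (f : ℝ → ℂ)) (𝓕 f).integrable
  rw [integral_fourier_eq_apply_zero] at h
  refine h.congr fun u ↦ ?_
  rw [← integral_indicator measurableSet_Ioi, ← integral_indicator measurableSet_Ioi,
    ← integral_sub_right_eq_self _ u]
  congr with y
  simp [Set.indicator_apply]

theorem tendsto_setIntegral_exp_mul_fourier (f : 𝓢(ℝ, ℂ)) (u : ℝ) :
    Tendsto (fun σ : ℝ ↦ ∫ y in Set.Ioi (0 : ℝ),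
      Complex.exp (-(σ - 1) * y) * 𝓕 (f : ℝ → ℂ) (y - u)) (𝓝[>] 1)
      (𝓝 (∫ y in Set.Ioi (0 : ℝ), 𝓕 (f : ℝ → ℂ) (y - u))) := by
  have hF : Continuous (𝓕 (f : ℝ → ℂ)) := (𝓕 f).continuous
  have hFi : Integrable (𝓕 (f : ℝ → ℂ)) := (𝓕 f).integrable
  refine tendsto_integral_filter_of_dominated_convergence (fun y ↦ ‖𝓕 (f : ℝ → ℂ) (y - u)‖)
    (Eventually.of_forall fun σ ↦ Continuous.aestronglyMeasurable (by fun_prop)) ?_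
    (hFi.comp_sub_right u).norm.integrableOn ?_
  · filter_upwards [self_mem_nhdsWithin] with σ hσ
    filter_upwards [ae_restrict_mem measurableSet_Ioi] with y hy
    rw [norm_mul, Complex.norm_exp]
    refine mul_le_of_le_one_left (norm_nonneg _) (Real.exp_le_one_iff.2 ?_)
    simp only [Set.mem_Ioi] at hσ hy
    simp
    nlinarith
  · refine ae_of_all _ fun y ↦ ?_
    have : Continuous fun σ : ℝ ↦ Complex.exp (-(σ - 1) * y) * 𝓕 (f : ℝ → ℂ) (y - u) := by
      fun_prop
    simpa using (this.tendsto 1).mono_left nhdsWithin_le_nhds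

/-- A smoothed lower bound of Wiener-Ikehara type for the von Mangoldt function. -/
theorem eventually_exists_half_lt_norm_tsum (f : 𝓢(ℝ, ℂ)) (hf : HasCompactSupport f)
    (hf0 : f 0 = 1) :
    ∀ᶠ u : ℝ in atTop, ∃ σ : ℝ, 1 < σ ∧
      1 / 2 < ‖∑' n : ℕ, ((Λ n * (n : ℝ) ^ (-σ) : ℝ) : ℂ) *
        𝓕 (f : ℝ → ℂ) (Real.log n - u)‖ := by
  obtain ⟨G, hG, hGL⟩ := exists_continuousOn_eq_LSeries_vonMangoldt_sub
  have hfc := f.continuous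
  set J : ℝ → ℝ → ℂ := fun u σ ↦ ∫ t : ℝ, f t * Complex.exp (2 * Real.pi * t * u * Complex.I) *
    G (σ + 2 * Real.pi * t * Complex.I)
  have hGc : ContinuousOn (fun p : ℝ × ℝ ↦ G (p.1 + 2 * Real.pi * p.2 * Complex.I))
      (Set.Ici 1 ×ˢ Set.univ) :=
    hG.comp (by fun_prop) fun p hp ↦ by simpa using hp.1
  have hGσ {σ : ℝ} (hσ : 1 ≤ σ) : Continuous fun t : ℝ ↦ G (σ + 2 * Real.pi * t * Complex.I) :=
    continuousOn_univ.1 <| hG.comp (by fun_prop) fun t _ ↦ by simpa using hσ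
  have hJ (u : ℝ) : Tendsto (J u) (𝓝[>] 1) (𝓝 (J u 1)) := by
    have : ContinuousOn (J u) (Set.Ici 1) := by
      refine continuousOn_integral_of_compact_support hf.isCompact ?_ fun σ t _ ht ↦ by
        simp [image_eq_zero_of_notMem_tsupport ht]
      exact ContinuousOn.mul (by fun_prop) hGc
    exact (this 1 Set.self_mem_Ici).mono_left (nhdsWithin_mono _ Set.Ioi_subset_Ici_self)
  have hJ0 : Tendsto (fun u ↦ J u 1) atTop (𝓝 0) := by
    have h := ((Real.zero_at_infty_fourier fun t : ℝ ↦
      f t * G (1 + 2 * Real.pi * t * Complex.I)).mono_left atBot_le_cocompact).comp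
      tendsto_neg_atTop_atBot
    refine h.congr fun u ↦ ?_
    rw [Function.comp_apply, Real.fourier_real_eq_integral_exp_smul]
    simp only [J]
    congr with t
    push_cast
    rw [smul_eq_mul]
    ring_nf
  have hlim := hJ0.add (tendsto_setIntegral_Ioi_fourier_sub f)
  rw [hf0, zero_add] at hlim
  filter_upwards [hlim.norm.eventually_const_lt (u := 1 / 2) (by norm_num)] with u hu
  have h := ((hJ u).add (tendsto_setIntegral_exp_mul_fourier f u)).norm.eventually_const_lt hu
  obtain ⟨σ, hσ, h1⟩ := (h.and self_mem_nhdsWithin).exists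
  refine ⟨σ, h1, ?_⟩
  rw [(hasSum_vonMangoldt_mul_fourier f h1 u).tsum_eq]
  refine hσ.trans_eq (congrArg norm ?_)
  rw [setIntegral_exp_mul_fourier f h1 u, ← integral_add]
  · congr with t
    rw [hGL _ (by simpa using h1)]
    ring
  · exact (((hfc.mul (by fun_prop)).mul (hGσ h1.le))).integrable_of_hasCompactSupport
      (hf.mul_right.mul_right)
  · refine Continuous.integrable_of_hasCompactSupport ((hfc.mul (by fun_prop)).mul ?_)
      (hf.mul_right.mul_right)
    refine continuous_const.div (by fun_prop) fun t h0 ↦ ?_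
    have := congrArg Complex.re h0
    simp at this
    linarith

theorem summable_one_div_one_add_intCast_sq : Summable fun k : ℤ ↦ 1 / (1 + (k : ℝ) ^ 2) := by
  refine (Real.summable_one_div_int_pow (p := 2).2 one_lt_two).of_norm_bounded_eventually ?_
  filter_upwards [(Set.finite_singleton (0 : ℤ)).compl_mem_cofinite] with k hk
  have hk' : (k : ℝ) ≠ 0 := by simpa using hk
  rw [Real.norm_of_nonneg (by positivity)]
  gcongr
  linarith

theorem sum_vonMangoldt_div_le (s : Finset ℕ) (a : ℝ)
    (hs : ∀ n ∈ s, n ≠ 0 → a ≤ Real.log n ∧ Real.log n ≤ a + 1) :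
    ∑ n ∈ s, Λ n / n ≤ (Real.log 4 + 4) * Real.exp 1 := by
  calc ∑ n ∈ s, Λ n / n ≤ ∑ n ∈ s, Λ n / Real.exp a := by
        refine Finset.sum_le_sum fun n hn ↦ ?_
        rcases eq_or_ne n 0 with rfl | h0
        · simp
        have : 0 < (n : ℝ) := by positivity
        gcongr
        exact (Real.le_log_iff_exp_le this).1 (hs n hn h0).1
    _ = (∑ n ∈ s with n ≠ 0, Λ n) / Real.exp a := by
        rw [← Finset.sum_div, Finset.sum_filter]
        congr 1
        refine Finset.sum_congr rfl fun n _ ↦ ?_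
        split_ifs with h
        · rfl
        · simp [not_not.1 h]
    _ ≤ Chebyshev.psi (Real.exp (a + 1)) / Real.exp a := by
        gcongr
        refine Finset.sum_le_sum_of_subset_of_nonneg (fun n hn ↦ ?_) fun _ _ _ ↦ vonMangoldt_nonneg
        obtain ⟨hn, h0⟩ := Finset.mem_filter.1 hn
        exact Finset.mem_Ioc.2 ⟨Nat.pos_of_ne_zero h0, Nat.le_floor
          ((Real.log_le_iff_le_exp (by positivity)).1 (hs n hn h0).2)⟩
    _ ≤ (Real.log 4 + 4) * Real.exp (a + 1) / Real.exp a := by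
        gcongr
        exact Chebyshev.psi_le_const_mul_self (Real.exp_nonneg _)
    _ = (Real.log 4 + 4) * Real.exp 1 := by
        rw [Real.exp_add]
        field_simp

/-- A Chebyshev-type upper bound, uniform in the centre `u`, for sums of `Λ n / n` with quadratic
decay in `log n - u`. -/
theorem exists_hasSum_vonMangoldt_div_one_add_sq_le :
    ∃ B : ℝ, ∀ u : ℝ, ∃ S ≤ B,
      HasSum (fun n : ℕ ↦ Λ n / n * (1 / (1 + (Real.log n - u) ^ 2))) S := by
  set A := (Real.log 4 + 4) * Real.exp 1
  have hA : 0 ≤ A := by positivity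
  refine ⟨∑' k : ℤ, A * (4 * (1 / (1 + (k : ℝ) ^ 2))), fun u ↦ ?_⟩
  have hnonneg (n : ℕ) : 0 ≤ Λ n / n * (1 / (1 + (Real.log n - u) ^ 2)) :=
    mul_nonneg (div_nonneg vonMangoldt_nonneg n.cast_nonneg) (by positivity)
  have hsum (s : Finset ℕ) : ∑ n ∈ s, Λ n / n * (1 / (1 + (Real.log n - u) ^ 2)) ≤
      ∑' k : ℤ, A * (4 * (1 / (1 + (k : ℝ) ^ 2))) := by
    set κ : ℕ → ℤ := fun n ↦ ⌊Real.log n - u⌋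
    rw [← Finset.sum_fiberwise_of_maps_to (t := s.image κ) fun n hn ↦ Finset.mem_image_of_mem κ hn]
    refine le_trans (Finset.sum_le_sum fun k _ ↦ ?_)
      (((summable_one_div_one_add_intCast_sq.mul_left 4).mul_left A).sum_le_tsum _
        fun k _ ↦ by positivity)
    have hκ {n : ℕ} (hn : κ n = k) : (k : ℝ) ≤ Real.log n - u ∧ Real.log n - u < k + 1 :=
      Int.floor_eq_iff.1 hn
    calc ∑ n ∈ s with κ n = k, Λ n / n * (1 / (1 + (Real.log n - u) ^ 2))
        ≤ ∑ n ∈ s with κ n = k, Λ n / n * (4 * (1 / (1 + (k : ℝ) ^ 2))) := by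
          refine Finset.sum_le_sum fun n hn ↦ mul_le_mul_of_nonneg_left ?_
            (div_nonneg vonMangoldt_nonneg n.cast_nonneg)
          obtain ⟨h1, h2⟩ := hκ (Finset.mem_filter.1 hn).2
          rw [mul_one_div, div_le_div_iff₀ (by positivity) (by positivity)]
          nlinarith [sq_nonneg (3 * (k : ℝ) + 4 * (Real.log n - u - k))]
      _ ≤ A * (4 * (1 / (1 + (k : ℝ) ^ 2))) := by
          rw [← Finset.sum_mul]
          gcongr
          refine sum_vonMangoldt_div_le _ (u + k) fun n hn _ ↦ ?_
          obtain ⟨h1, h2⟩ := hκ (Finset.mem_filter.1 hn).2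
          constructor <;> linarith
  exact ⟨_, Real.tsum_le_of_sum_le hnonneg hsum, (summable_of_sum_le hnonneg hsum).hasSum⟩

/-- A compactly supported test function whose Fourier transform is arbitrarily small away from `0`. -/
theorem exists_compactSupport_fourier_le {η ε : ℝ} (hη : 0 < η) (hε : 0 < ε) :
    ∃ f : 𝓢(ℝ, ℂ), HasCompactSupport f ∧ f 0 = 1 ∧ (∃ M, ∀ y, ‖𝓕 (f : ℝ → ℂ) y‖ ≤ M) ∧
      ∀ y, η < |y| → ‖𝓕 (f : ℝ → ℂ) y‖ ≤ ε * (1 / (1 + y ^ 2)) := by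
  let b : ContDiffBump (0 : ℝ) := ⟨1, 2, one_pos, one_lt_two⟩
  let g : ℝ → ℂ := fun t ↦ (b t : ℂ)
  have hg : HasCompactSupport g := b.hasCompactSupport.comp_left Complex.ofReal_zero
  have hgs : ContDiff ℝ (⊤ : ℕ∞) g := Complex.ofRealCLM.contDiff.comp b.contDiff
  let φ : 𝓢(ℝ, ℂ) := hg.toSchwartzMap hgs
  obtain ⟨C, hC, hφ⟩ := (𝓕 φ).decay 2 0
  simp only [norm_iteratedFDeriv_zero, Real.norm_eq_abs, sq_abs] at hφ
  set T := C * (1 + 1 / η ^ 2) / ε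
  have hT : 0 < T := by positivity
  have hfc : HasCompactSupport fun t ↦ g (T⁻¹ * t) :=
    hg.comp_homeomorph (Homeomorph.mulLeft₀ T⁻¹ (by positivity))
  have hfs : ContDiff ℝ (⊤ : ℕ∞) fun t ↦ g (T⁻¹ * t) := hgs.comp (by fun_prop)
  let f : 𝓢(ℝ, ℂ) := hfc.toSchwartzMap hfs
  have hF (y : ℝ) : 𝓕 (f : ℝ → ℂ) y = T * 𝓕 (φ : ℝ → ℂ) (T * y) := by
    rw [Real.fourier_real_eq_integral_exp_smul, Real.fourier_real_eq_integral_exp_smul]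
    have := Measure.integral_comp_div (fun v : ℝ ↦
      Complex.exp (↑(-2 * Real.pi * v * (T * y)) * Complex.I) • φ v) T
    rw [abs_of_pos hT, Complex.real_smul] at this
    rw [← this]
    congr with v
    congr 1
    · congr 3
      field_simp
    · change g (T⁻¹ * v) = g (v / T)
      rw [div_eq_inv_mul]
  refine ⟨f, hfc, ?_, ?_, fun y hy ↦ ?_⟩
  · change ((b (T⁻¹ * 0) : ℝ) : ℂ) = 1
    rw [mul_zero, b.one_of_mem_closedBall (by simp [b]), Complex.ofReal_one]
  · obtain ⟨M, -, hM⟩ := (𝓕 f).decay 0 0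
    exact ⟨M, fun y ↦ by simpa [fourier_coe] using hM y⟩
  · have hy2 : η ^ 2 < y ^ 2 := by
      rw [← sq_abs y]
      gcongr
    have hy0 : 0 < y ^ 2 := (by positivity : 0 < η ^ 2).trans hy2
    have h := hφ (T * y)
    rw [← fourier_coe] at hF
    rw [← fourier_coe, hF, norm_mul, Complex.norm_real, Real.norm_of_nonneg hT.le]
    have h1 : T * y ^ 2 * (T * ‖(𝓕 φ) (T * y)‖) ≤ C := by
      calc _ = (T * y) ^ 2 * ‖(𝓕 φ) (T * y)‖ := by ring
        _ ≤ C := h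
    rw [mul_one_div, le_div_iff₀ (by positivity)]
    have hTe : T * ε = C * (1 + 1 / η ^ 2) := by simp only [T]; field_simp
    have h2 : 1 + y ^ 2 ≤ (1 + 1 / η ^ 2) * y ^ 2 := by
      have : 1 ≤ y ^ 2 / η ^ 2 := (one_le_div (by positivity)).2 hy2.le
      calc 1 + y ^ 2 ≤ y ^ 2 / η ^ 2 + y ^ 2 := by gcongr
        _ = _ := by ring
    calc T * ‖(𝓕 φ) (T * y)‖ * (1 + y ^ 2)
        ≤ T * ‖(𝓕 φ) (T * y)‖ * ((1 + 1 / η ^ 2) * y ^ 2) := by gcongr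
      _ = (1 + 1 / η ^ 2) / T * (T * y ^ 2 * (T * ‖(𝓕 φ) (T * y)‖)) := by field_simp
      _ ≤ (1 + 1 / η ^ 2) / T * C := by gcongr
      _ = ε := by rw [div_mul_eq_mul_div, div_eq_iff hT.ne', mul_comm ε, hTe]; ring

/-- The interval `(x / m, x]` carries a positive proportion of the mass of `ψ x`, for any `m > 1`. -/
theorem exists_mul_le_psi_sub_psi_div {m : ℝ} (hm : 1 < m) :
    ∃ c > 0, ∀ᶠ x : ℝ in atTop, c * x ≤ Chebyshev.psi x - Chebyshev.psi (x / m) := by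
  set η := Real.log m / 3 with hη'
  have hη : 0 < η := div_pos (Real.log_pos hm) three_pos
  obtain ⟨B, hB⟩ := exists_hasSum_vonMangoldt_div_one_add_sq_le
  obtain ⟨f, hf, hf0, ⟨M, hM⟩, hfε⟩ := exists_compactSupport_fourier_le hη
    (ε := 1 / (4 * (|B| + 1))) (by positivity)
  set ε := 1 / (4 * (|B| + 1)) with hε'
  have hε : 0 < ε := by positivity
  have hεB : ε * B ≤ 1 / 4 := by
    rw [hε', div_mul_eq_mul_div, div_le_div_iff₀ (by positivity) (by positivity)]
    nlinarith [le_abs_self B]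
  have hM0 : 0 ≤ M := (norm_nonneg _).trans (hM 0)
  refine ⟨1 / (4 * (M + 1) * m), by positivity, ?_⟩
  have hev := (tendsto_atTop_add_const_right _ (-η) Real.tendsto_log_atTop).eventually
    (eventually_exists_half_lt_norm_tsum f hf hf0)
  filter_upwards [hev, eventually_gt_atTop 0] with x ⟨σ, hσ, hx⟩ hx0
  set u := Real.log x + -η with hu
  set s := Finset.Ioc ⌊x / m⌋₊ ⌊x⌋₊ with hs
  have hpsi : Chebyshev.psi x - Chebyshev.psi (x / m) = ∑ n ∈ s, Λ n := by
    rw [Chebyshev.psi, Chebyshev.psi, sub_eq_iff_eq_add', hs,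
      Finset.sum_Ioc_consecutive _ (Nat.zero_le _)]
    gcongr
    exact div_le_self hx0.le hm.le
  obtain ⟨S, hSB, hS⟩ := hB u
  have h1 : HasSum (fun n ↦ if n ∈ s then (M + 1) * (m / x) * Λ n else 0)
      (∑ n ∈ s, (M + 1) * (m / x) * Λ n) := by
    have h : HasSum (fun n ↦ if n ∈ s then (M + 1) * (m / x) * Λ n else 0) _ :=
      hasSum_sum_of_ne_finset_zero fun n hn ↦ if_neg hn
    rwa [Finset.sum_congr rfl fun n hn ↦ if_pos hn] at h
  have hbound := tsum_of_norm_bounded ((hS.mul_left ε).add h1) (f := fun n : ℕ ↦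
    ((Λ n * (n : ℝ) ^ (-σ) : ℝ) : ℂ) * 𝓕 (f : ℝ → ℂ) (Real.log n - u)) fun n ↦ by
    rcases eq_or_ne n 0 with rfl | hn
    · simp
    have hn0 : 0 < (n : ℝ) := by positivity
    have hn1 : 1 ≤ (n : ℝ) := by exact_mod_cast Nat.one_le_iff_ne_zero.2 hn
    have hΛ : 0 ≤ Λ n := vonMangoldt_nonneg
    have hpow : Λ n * (n : ℝ) ^ (-σ) ≤ Λ n / n := by
      rw [div_eq_mul_inv, ← Real.rpow_neg_one]
      gcongr
    have hnorm : ‖((Λ n * (n : ℝ) ^ (-σ) : ℝ) : ℂ)‖ ≤ Λ n / n := by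
      rwa [Complex.norm_real, Real.norm_of_nonneg (by positivity)]
    rw [norm_mul]
    rcases lt_or_ge η |Real.log n - u| with h | h
    · calc _ ≤ Λ n / n * (ε * (1 / (1 + (Real.log n - u) ^ 2))) := by
            gcongr
            exact hfε _ h
        _ = ε * (Λ n / n * (1 / (1 + (Real.log n - u) ^ 2))) := by ring
        _ ≤ _ := le_add_of_nonneg_right (by split_ifs <;> positivity)
    · obtain ⟨h2, h3⟩ := abs_le.1 h
      have hnx : (n : ℝ) ≤ x := (Real.log_le_log_iff hn0 hx0).1 (by linarith)
      have hxn : x / m < n := by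
        refine (Real.log_lt_log_iff (by positivity) hn0).1 ?_
        rw [Real.log_div hx0.ne' (by positivity)]
        linarith
      have hns : n ∈ s := Finset.mem_Ioc.2
        ⟨(Nat.floor_lt (by positivity)).2 hxn, Nat.le_floor hnx⟩
      rw [if_pos hns]
      calc _ ≤ Λ n / n * M := by
            gcongr
            exact hM _
        _ ≤ Λ n / (x / m) * (M + 1) := by
            gcongr
            linarith
        _ = (M + 1) * (m / x) * Λ n := by
            field_simp
        _ ≤ _ := le_add_of_nonneg_left (by positivity)
  rw [← Finset.mul_sum, ← hpsi] at hbound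
  have h4 : ε * S ≤ 1 / 4 := (mul_le_mul_of_nonneg_left hSB hε.le).trans hεB
  have h5 : 1 / 4 ≤ (M + 1) * (m / x) * (Chebyshev.psi x - Chebyshev.psi (x / m)) := by linarith
  calc 1 / (4 * (M + 1) * m) * x = x / ((M + 1) * m) * (1 / 4) := by field_simp
    _ ≤ x / ((M + 1) * m) * ((M + 1) * (m / x) * (Chebyshev.psi x - Chebyshev.psi (x / m))) := by
      gcongr
    _ = _ := by field_simp

theorem theta_sub_theta_div_le {m x : ℝ} (hm : 1 < m) (hx : 1 ≤ x) :
    Chebyshev.theta x - Chebyshev.theta (x / m) ≤ (piR x - piR (x / m) : ℕ) * Real.log x := by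
  have hle : ⌊x / m⌋₊ ≤ ⌊x⌋₊ := Nat.floor_le_floor (div_le_self (by linarith) hm.le)
  have hsub : Nat.primesLE ⌊x / m⌋₊ ⊆ Nat.primesLE ⌊x⌋₊ := fun p hp ↦ by
    rw [Nat.mem_primesLE] at hp ⊢
    exact ⟨hp.1.trans hle, hp.2⟩
  rw [Chebyshev.theta_eq_sum_primesLE, Chebyshev.theta_eq_sum_primesLE,
    ← Finset.sum_sdiff_eq_sub hsub, piR, piR, ← Nat.primesLE_card_eq_primeCounting,
    ← Nat.primesLE_card_eq_primeCounting, ← Finset.card_sdiff_of_subset hsub, ← nsmul_eq_mul]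
  refine Finset.sum_le_card_nsmul _ _ _ fun p hp ↦ ?_
  have hp' := Nat.mem_primesLE.1 (Finset.mem_sdiff.1 hp).1
  have hp0 : 0 < (p : ℝ) := by exact_mod_cast hp'.2.pos
  gcongr
  exact (Nat.le_floor_iff (by linarith)).1 hp'.1

theorem eventually_le_piR_sub_piR_div {m : ℝ} (hm : 1 < m) (n : ℕ) :
    ∀ᶠ x : ℝ in atTop, n ≤ piR x - piR (x / m) := by
  obtain ⟨c, hc, hev⟩ := exists_mul_le_psi_sub_psi_div hm
  have hlog := Real.isLittleO_log_id_atTop.bound (c := c / (4 * (n + 1))) (by positivity)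
  obtain ⟨C, hC⟩ := Chebyshev.psi_sub_theta_le_mul_sqrt
  filter_upwards [hev, hlog, eventually_gt_atTop 1,
    Real.tendsto_sqrt_atTop.eventually_ge_atTop (2 * C / c)] with x hx hlogx hx1 hsqrt
  have hl : 0 < Real.log x := Real.log_pos hx1
  rw [Real.norm_of_nonneg hl.le, id, Real.norm_of_nonneg (by linarith), div_mul_eq_mul_div,
    le_div_iff₀ (by positivity)] at hlogx
  have h1 : C * √x ≤ c / 2 * x := by
    rw [div_le_iff₀ hc] at hsqrt
    nlinarith [Real.sq_sqrt (by linarith : 0 ≤ x), Real.sqrt_nonneg x]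
  have h2 := theta_sub_theta_div_le hm hx1.le
  have h3 := hC x
  have h4 := Chebyshev.theta_le_psi (x / m)
  have h5 : (n : ℝ) * Real.log x ≤ (piR x - piR (x / m) : ℕ) * Real.log x := by nlinarith
  exact_mod_cast le_of_mul_le_mul_right h5 hl

theorem piR_mono : Monotone piR := fun _ _ h ↦ Nat.monotone_primeCounting (Nat.floor_le_floor h)

theorem piR_natCast_succ_of_not_prime {k : ℕ} (hk : ¬ (k + 1).Prime) :
    piR ((k + 1 : ℕ) : ℝ) = piR (k : ℝ) := by
  rw [piR, piR, Nat.floor_natCast, Nat.floor_natCast, Nat.primeCounting, Nat.primeCounting,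
    Nat.primeCounting', Nat.count_succ, if_neg hk, add_zero]

theorem stmt_19 (m : ℝ) (hm : 1 < m) (n : ℕ) (hn : 1 ≤ n) :
    ∃ R : ℕ, IsLeast {R : ℕ | 0 < R ∧ ∀ x : ℝ, (R : ℝ) ≤ x →
      n ≤ piR x - piR (x / m)} R ∧ R.Prime := by
  have hne : {R : ℕ | 0 < R ∧ ∀ x : ℝ, (R : ℝ) ≤ x → n ≤ piR x - piR (x / m)}.Nonempty := by
    obtain ⟨a, ha⟩ := eventually_atTop.1 (eventually_le_piR_sub_piR_div hm n)
    exact ⟨⌈a⌉₊ + 1, Nat.succ_pos _, fun x hx ↦ ha x (by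
      push_cast at hx
      linarith [Nat.le_ceil a])⟩
  obtain ⟨R, hR⟩ : ∃ R, IsLeast _ R := ⟨_, Nat.sInf_mem hne, fun _ h ↦ Nat.sInf_le h⟩
  refine ⟨R, hR, ?_⟩
  by_contra hnp
  obtain ⟨⟨hR0, hRx⟩, hmin⟩ := hR
  obtain ⟨k, rfl⟩ := Nat.exists_eq_add_one_of_ne_zero hR0.ne'
  have hpi := piR_natCast_succ_of_not_prime hnp
  have hk : 0 < k := by
    rcases Nat.eq_zero_or_pos k with rfl | hk
    · have h1 := hRx _ le_rfl
      rw [hpi] at h1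
      simp [piR] at h1
      omega
    · exact hk
  have hmem := hmin (a := k) ⟨hk, fun x hx ↦ ?_⟩
  · omega
  · rcases le_or_gt ((k + 1 : ℕ) : ℝ) x with h | h
    · exact hRx x h
    · have h1 := hRx _ le_rfl
      have h2 : piR (x / m) ≤ piR (((k + 1 : ℕ) : ℝ) / m) := piR_mono (by gcongr)
      have h3 := piR_mono hx
      omega
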